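/- arXiv:2005.11588 — 9 statements merged into one kernel-verified Lean document; each statement's English description precedes it below -/
import Mathlib

section
/- A point λ ∈ ℝ^m with λ ≤ 0 componentwise attains the infimum of L over the nonpositive orthant if and only if Aᵀλ = y − φ* and Bᵀλ = −ρ·ξ*, where (φ*, ξ*) is the unique primal minimizer. In particular, the set of dual optimal solutions is the polyhedron { λ ∈ ℝ^m : λ ≤ 0, Aᵀλ = y − φ*, Bᵀλ = −ρξ* }. -/
open Matrix Finset

/-- Primal objective `f(φ, ξ) = (1/2)‖y − φ‖² + (ρ/2)‖ξ‖²`. -/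
noncomputable def primalObj {n p : ℕ} (y : Fin n → ℝ) (ρ : ℝ)
    (φ : Fin n → ℝ) (ξ : Fin p → ℝ) : ℝ :=
  (1/2) * ∑ i, (y i - φ i)^2 + ρ/2 * ∑ j, (ξ j)^2

/-- Primal feasibility `Aφ + Bξ ≥ 0` componentwise. -/
def primalFeas {m n p : ℕ} (A : Matrix (Fin m) (Fin n) ℝ) (B : Matrix (Fin m) (Fin p) ℝ)
    (φ : Fin n → ℝ) (ξ : Fin p → ℝ) : Prop :=
  ∀ i, 0 ≤ (A.mulVec φ + B.mulVec ξ) i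

/-- Dual objective `L(λ) = (1/(2ρ))·λᵀ(ρAAᵀ + BBᵀ)λ − yᵀAᵀλ`. -/
noncomputable def dualObj {m n p : ℕ} (A : Matrix (Fin m) (Fin n) ℝ) (B : Matrix (Fin m) (Fin p) ℝ)
    (y : Fin n → ℝ) (ρ : ℝ) (lam : Fin m → ℝ) : ℝ :=
  (1/(2*ρ)) * (lam ⬝ᵥ ((ρ • (A * Aᵀ) + B * Bᵀ).mulVec lam)) - y ⬝ᵥ (Aᵀ.mulVec lam)

theorem nonneg_of_forall_unit_quadratic_nonneg {a b : ℝ}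
    (h : ∀ t : ℝ, 0 < t → t ≤ 1 → 0 ≤ t * a + t ^ 2 * b) : 0 ≤ a := by
  by_contra! ha
  have hd : 0 < |b| - a := by have := abs_nonneg b; linarith
  have h2 : 0 < 2 * (|b| - a) := by linarith
  have ht : 0 < -a / (2 * (|b| - a)) := div_pos (by linarith) h2
  have ht1 : -a / (2 * (|b| - a)) ≤ 1 := by
    rw [div_le_one h2]; have := abs_nonneg b; linarith
  have key := h _ ht ht1
  set t := -a / (2 * (|b| - a)) with htd
  have h3 : t * (2 * (|b| - a)) = -a := by rw [htd]; field_simp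
  have h4 : 0 ≤ a + t * b := by
    by_contra! hc
    nlinarith [mul_neg_of_pos_of_neg ht hc]
  nlinarith [mul_le_mul_of_nonneg_left (le_abs_self b) ht.le, mul_pos ht (neg_pos.2 ha)]

theorem primalObj_add {n p : ℕ} (y : Fin n → ℝ) (ρ : ℝ) (φ a : Fin n → ℝ) (ξ b : Fin p → ℝ) :
    primalObj y ρ (φ + a) (ξ + b) = primalObj y ρ φ ξ + ((φ - y) ⬝ᵥ a + ρ * (ξ ⬝ᵥ b))
      + (1 / 2 * (a ⬝ᵥ a) + ρ / 2 * (b ⬝ᵥ b)) := by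
  have h1 : ∑ i, (y i - (φ + a) i) ^ 2
      = ∑ i, (y i - φ i) ^ 2 + 2 * ((φ - y) ⬝ᵥ a) + a ⬝ᵥ a := by
    simp only [dotProduct, Finset.mul_sum, ← Finset.sum_add_distrib]
    refine Finset.sum_congr rfl fun i _ => ?_
    simp only [Pi.add_apply, Pi.sub_apply]; ring
  have h2 : ∑ j, ((ξ + b) j) ^ 2 = ∑ j, (ξ j) ^ 2 + 2 * (ξ ⬝ᵥ b) + b ⬝ᵥ b := by
    simp only [dotProduct, Finset.mul_sum, ← Finset.sum_add_distrib]
    refine Finset.sum_congr rfl fun i _ => ?_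
    simp only [Pi.add_apply]; ring
  rw [primalObj, primalObj, h1, h2]; ring

theorem dualObj_eq {m n p : ℕ} (A : Matrix (Fin m) (Fin n) ℝ) (B : Matrix (Fin m) (Fin p) ℝ)
    (y : Fin n → ℝ) {ρ : ℝ} (hρ : ρ ≠ 0) (lam : Fin m → ℝ) :
    dualObj A B y ρ lam = 1 / 2 * ((Aᵀ *ᵥ lam) ⬝ᵥ (Aᵀ *ᵥ lam))
      + 1 / (2 * ρ) * ((Bᵀ *ᵥ lam) ⬝ᵥ (Bᵀ *ᵥ lam)) - y ⬝ᵥ (Aᵀ *ᵥ lam) := by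
  have hA : lam ⬝ᵥ (A *ᵥ (Aᵀ *ᵥ lam)) = (Aᵀ *ᵥ lam) ⬝ᵥ (Aᵀ *ᵥ lam) := by
    rw [dotProduct_mulVec, ← mulVec_transpose]
  have hB : lam ⬝ᵥ (B *ᵥ (Bᵀ *ᵥ lam)) = (Bᵀ *ᵥ lam) ⬝ᵥ (Bᵀ *ᵥ lam) := by
    rw [dotProduct_mulVec, ← mulVec_transpose]
  rw [dualObj, add_mulVec, smul_mulVec, ← mulVec_mulVec, ← mulVec_mulVec, dotProduct_add,
    dotProduct_smul, hA, hB, smul_eq_mul]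
  field_simp

theorem dualObj_add {m n p : ℕ} (A : Matrix (Fin m) (Fin n) ℝ) (B : Matrix (Fin m) (Fin p) ℝ)
    (y : Fin n → ℝ) {ρ : ℝ} (hρ : ρ ≠ 0) (lam d : Fin m → ℝ) (φ : Fin n → ℝ) (ξ : Fin p → ℝ)
    (hA : Aᵀ *ᵥ lam = y - φ) (hB : Bᵀ *ᵥ lam = -(ρ • ξ)) :
    dualObj A B y ρ (lam + d) = dualObj A B y ρ lam - (A *ᵥ φ + B *ᵥ ξ) ⬝ᵥ d
      + (1 / 2 * ((Aᵀ *ᵥ d) ⬝ᵥ (Aᵀ *ᵥ d)) + 1 / (2 * ρ) * ((Bᵀ *ᵥ d) ⬝ᵥ (Bᵀ *ᵥ d))) := by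
  have h1 : (A *ᵥ φ) ⬝ᵥ d = φ ⬝ᵥ (Aᵀ *ᵥ d) := by
    rw [dotProduct_comm, dotProduct_mulVec, ← mulVec_transpose, dotProduct_comm]
  have h2 : (B *ᵥ ξ) ⬝ᵥ d = ξ ⬝ᵥ (Bᵀ *ᵥ d) := by
    rw [dotProduct_comm, dotProduct_mulVec, ← mulVec_transpose, dotProduct_comm]
  rw [dualObj_eq A B y hρ, dualObj_eq A B y hρ, mulVec_add, mulVec_add, add_dotProduct (A *ᵥ φ),
    h1, h2, hA, hB]
  generalize Aᵀ *ᵥ d = u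
  generalize Bᵀ *ᵥ d = v
  simp only [add_dotProduct, dotProduct_add, sub_dotProduct, dotProduct_sub, neg_dotProduct,
    dotProduct_neg, smul_dotProduct, dotProduct_smul, smul_eq_mul, dotProduct_comm u,
    dotProduct_comm v, dotProduct_comm φ y]
  field_simp
  ring

theorem primalFeas_smul {m n p : ℕ} {A : Matrix (Fin m) (Fin n) ℝ} {B : Matrix (Fin m) (Fin p) ℝ}
    {φ : Fin n → ℝ} {ξ : Fin p → ℝ} (h : primalFeas A B φ ξ) {c : ℝ} (hc : 0 ≤ c) :
    primalFeas A B (c • φ) (c • ξ) := by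
  intro i
  rw [mulVec_smul, mulVec_smul, ← smul_add]
  exact mul_nonneg hc (h i)

/-- The residual of a primal minimizer is orthogonal to it, as the feasible set is a cone. -/
theorem primal_complementarity {m n p : ℕ} {A : Matrix (Fin m) (Fin n) ℝ}
    {B : Matrix (Fin m) (Fin p) ℝ} {y : Fin n → ℝ} {ρ : ℝ} {φ : Fin n → ℝ} {ξ : Fin p → ℝ}
    (hfeas : primalFeas A B φ ξ)
    (hmin : ∀ (φ' : Fin n → ℝ) (ξ' : Fin p → ℝ), primalFeas A B φ' ξ' →
      primalObj y ρ φ ξ ≤ primalObj y ρ φ' ξ') :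
    (φ - y) ⬝ᵥ φ + ρ * (ξ ⬝ᵥ ξ) = 0 := by
  have key : ∀ t : ℝ, -1 ≤ t → 0 ≤ t * ((φ - y) ⬝ᵥ φ + ρ * (ξ ⬝ᵥ ξ))
      + t ^ 2 * (1 / 2 * (φ ⬝ᵥ φ) + ρ / 2 * (ξ ⬝ᵥ ξ)) := by
    intro t ht
    have h := hmin _ _ (primalFeas_smul hfeas (c := 1 + t) (by linarith))
    rw [add_smul, add_smul, one_smul, one_smul, primalObj_add] at h
    simp only [smul_dotProduct, dotProduct_smul, smul_eq_mul] at h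
    linarith
  refine le_antisymm ?_ (nonneg_of_forall_unit_quadratic_nonneg fun t h0 _ => key t (by linarith))
  refine neg_nonneg.1 (nonneg_of_forall_unit_quadratic_nonneg
    (b := 1 / 2 * (φ ⬝ᵥ φ) + ρ / 2 * (ξ ⬝ᵥ ξ)) fun t _ h1 => ?_)
  have := key (-t) (by linarith)
  linarith

/-- First-order optimality over the nonpositive orthant for the dual objective. -/
theorem dual_variational_ineq {m n p : ℕ} {A : Matrix (Fin m) (Fin n) ℝ}
    {B : Matrix (Fin m) (Fin p) ℝ} {y : Fin n → ℝ} {ρ : ℝ} (hρ : ρ ≠ 0) {lam : Fin m → ℝ}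
    {φ : Fin n → ℝ} {ξ : Fin p → ℝ}
    (hA : Aᵀ *ᵥ lam = y - φ) (hB : Bᵀ *ᵥ lam = -(ρ • ξ)) (hlam : ∀ i, lam i ≤ 0)
    (hmin : ∀ lam' : Fin m → ℝ, (∀ i, lam' i ≤ 0) →
      dualObj A B y ρ lam ≤ dualObj A B y ρ lam')
    (d : Fin m → ℝ) (hd : ∀ i, (lam + d) i ≤ 0) :
    (A *ᵥ φ + B *ᵥ ξ) ⬝ᵥ d ≤ 0 := by
  refine neg_nonneg.1 (nonneg_of_forall_unit_quadratic_nonneg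
    (b := 1 / 2 * ((Aᵀ *ᵥ d) ⬝ᵥ (Aᵀ *ᵥ d)) + 1 / (2 * ρ) * ((Bᵀ *ᵥ d) ⬝ᵥ (Bᵀ *ᵥ d)))
    fun t h0 h1 => ?_)
  have h := hmin (lam + t • d) fun i => by
    have h2 := hlam i
    have h3 := hd i
    simp only [Pi.add_apply, Pi.smul_apply, smul_eq_mul] at h3 ⊢
    nlinarith
  rw [dualObj_add A B y hρ lam _ φ ξ hA hB] at h
  simp only [mulVec_smul, smul_dotProduct, dotProduct_smul, smul_eq_mul] at h
  linarith

theorem dotProduct_nonpos_of_nonneg_of_nonpos {m : ℕ} {s l : Fin m → ℝ} (hs : ∀ i, 0 ≤ s i)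
    (hl : ∀ i, l i ≤ 0) : s ⬝ᵥ l ≤ 0 :=
  Finset.sum_nonpos fun i _ => mul_nonpos_of_nonneg_of_nonpos (hs i) (hl i)

theorem dotProduct_self_nonneg_real {n : ℕ} (v : Fin n → ℝ) : 0 ≤ v ⬝ᵥ v :=
  Finset.sum_nonneg fun i _ => mul_self_nonneg (v i)

theorem residual_dotProduct {m n p : ℕ} {A : Matrix (Fin m) (Fin n) ℝ}
    {B : Matrix (Fin m) (Fin p) ℝ} {y : Fin n → ℝ} {ρ : ℝ} {lam : Fin m → ℝ}
    {φ : Fin n → ℝ} {ξ : Fin p → ℝ}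
    (hA : Aᵀ *ᵥ lam = y - φ) (hB : Bᵀ *ᵥ lam = -(ρ • ξ)) (a : Fin n → ℝ) (b : Fin p → ℝ) :
    (A *ᵥ a + B *ᵥ b) ⬝ᵥ lam = -((φ - y) ⬝ᵥ a + ρ * (ξ ⬝ᵥ b)) := by
  rw [dotProduct_comm, dotProduct_add, dotProduct_mulVec, dotProduct_mulVec, ← mulVec_transpose,
    ← mulVec_transpose, hA, hB]
  simp only [sub_dotProduct, neg_dotProduct, smul_dotProduct, smul_eq_mul]
  ring

theorem dual_optimal_of_eq {m n p : ℕ} {A : Matrix (Fin m) (Fin n) ℝ}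
    {B : Matrix (Fin m) (Fin p) ℝ} {y : Fin n → ℝ} {ρ : ℝ} (hρ : 0 < ρ) {lam : Fin m → ℝ}
    {φ : Fin n → ℝ} {ξ : Fin p → ℝ} (hfeas : primalFeas A B φ ξ)
    (hmin : ∀ (φ' : Fin n → ℝ) (ξ' : Fin p → ℝ), primalFeas A B φ' ξ' →
      primalObj y ρ φ ξ ≤ primalObj y ρ φ' ξ')
    (hA : Aᵀ *ᵥ lam = y - φ) (hB : Bᵀ *ᵥ lam = -(ρ • ξ))
    (lam' : Fin m → ℝ) (hlam' : ∀ i, lam' i ≤ 0) :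
    dualObj A B y ρ lam ≤ dualObj A B y ρ lam' := by
  have h := dualObj_add A B y hρ.ne' lam (lam' - lam) φ ξ hA hB
  rw [add_sub_cancel, dotProduct_sub, residual_dotProduct hA hB,
    primal_complementarity hfeas hmin] at h
  have h1 := dotProduct_nonpos_of_nonneg_of_nonpos hfeas hlam'
  have h2 := dotProduct_self_nonneg_real (Aᵀ *ᵥ (lam' - lam))
  have h3 := mul_nonneg (by positivity : 0 ≤ 1 / (2 * ρ))
    (dotProduct_self_nonneg_real (Bᵀ *ᵥ (lam' - lam)))
  linarith

theorem primal_optimal_of_dual_optimal {m n p : ℕ} {A : Matrix (Fin m) (Fin n) ℝ}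
    {B : Matrix (Fin m) (Fin p) ℝ} {y : Fin n → ℝ} {ρ : ℝ} (hρ : 0 < ρ) {lam : Fin m → ℝ}
    {φ : Fin n → ℝ} {ξ : Fin p → ℝ}
    (hA : Aᵀ *ᵥ lam = y - φ) (hB : Bᵀ *ᵥ lam = -(ρ • ξ)) (hlam : ∀ i, lam i ≤ 0)
    (hmin : ∀ lam' : Fin m → ℝ, (∀ i, lam' i ≤ 0) →
      dualObj A B y ρ lam ≤ dualObj A B y ρ lam') :
    primalFeas A B φ ξ ∧ ∀ (φ' : Fin n → ℝ) (ξ' : Fin p → ℝ), primalFeas A B φ' ξ' →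
      primalObj y ρ φ ξ ≤ primalObj y ρ φ' ξ' := by
  have hvar := dual_variational_ineq hρ.ne' hA hB hlam hmin
  refine ⟨fun i => ?_, fun φ' ξ' hfeas' => ?_⟩
  · have h := hvar (-Pi.single i 1) fun j => by
      have h1 : (0 : ℝ) ≤ (Pi.single i 1 : Fin m → ℝ) j :=
        (Pi.single_nonneg.2 zero_le_one : (0 : Fin m → ℝ) ≤ Pi.single i 1) j
      have h2 := hlam j
      simp only [Pi.add_apply, Pi.neg_apply]
      linarith
    rw [dotProduct_neg, dotProduct_single, mul_one] at h
    linarith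
  · have h0 := hvar (-lam) fun j => by simp
    rw [dotProduct_neg, residual_dotProduct hA hB] at h0
    have h1 := dotProduct_nonpos_of_nonneg_of_nonpos hfeas' hlam
    rw [residual_dotProduct hA hB] at h1
    have h := primalObj_add y ρ φ (φ' - φ) ξ (ξ' - ξ)
    rw [add_sub_cancel, add_sub_cancel, dotProduct_sub (φ - y), dotProduct_sub ξ] at h
    have h2 := dotProduct_self_nonneg_real (φ' - φ)
    have h3 := mul_nonneg (by positivity : 0 ≤ ρ / 2) (dotProduct_self_nonneg_real (ξ' - ξ))
    linarith

/-- A nonpositive `λ` attains the infimum of `L` over the nonpositive orthant iff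
`Aᵀλ = y − φ*` and `Bᵀλ = −ρξ*`, where `(φ*, ξ*)` is the unique primal minimizer.
In particular, the set of dual optimal solutions is the polyhedron
`{ λ : λ ≤ 0, Aᵀλ = y − φ*, Bᵀλ = −ρξ* }`. -/
theorem stmt1 (m n p : ℕ) (hm : 0 < m) (hn : 0 < n) (hp : 0 < p)
    (A : Matrix (Fin m) (Fin n) ℝ) (B : Matrix (Fin m) (Fin p) ℝ)
    (y : Fin n → ℝ) (ρ : ℝ) (hρ : 0 < ρ)
    (φs : Fin n → ℝ) (ξs : Fin p → ℝ)
    (hfeas : primalFeas A B φs ξs)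
    (hmin : ∀ (φ : Fin n → ℝ) (ξ : Fin p → ℝ), primalFeas A B φ ξ →
      primalObj y ρ φs ξs ≤ primalObj y ρ φ ξ)
    (huniq : ∀ (φ : Fin n → ℝ) (ξ : Fin p → ℝ), primalFeas A B φ ξ →
      (∀ (φ' : Fin n → ℝ) (ξ' : Fin p → ℝ), primalFeas A B φ' ξ' →
        primalObj y ρ φ ξ ≤ primalObj y ρ φ' ξ') → φ = φs ∧ ξ = ξs) :
    (∀ lam : Fin m → ℝ, (∀ i, lam i ≤ 0) →
      ((∀ lam' : Fin m → ℝ, (∀ i, lam' i ≤ 0) → dualObj A B y ρ lam ≤ dualObj A B y ρ lam') ↔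
        (Aᵀ.mulVec lam = y - φs ∧ Bᵀ.mulVec lam = -(ρ • ξs)))) ∧
    {lam : Fin m → ℝ | (∀ i, lam i ≤ 0) ∧
        ∀ lam' : Fin m → ℝ, (∀ i, lam' i ≤ 0) → dualObj A B y ρ lam ≤ dualObj A B y ρ lam'} =
      {lam : Fin m → ℝ | (∀ i, lam i ≤ 0) ∧
        Aᵀ.mulVec lam = y - φs ∧ Bᵀ.mulVec lam = -(ρ • ξs)} := by
  have main : ∀ lam : Fin m → ℝ, (∀ i, lam i ≤ 0) →
      ((∀ lam' : Fin m → ℝ, (∀ i, lam' i ≤ 0) → dualObj A B y ρ lam ≤ dualObj A B y ρ lam') ↔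
        (Aᵀ.mulVec lam = y - φs ∧ Bᵀ.mulVec lam = -(ρ • ξs))) := by
    intro lam hlam
    refine ⟨fun h => ?_, fun h => dual_optimal_of_eq hρ hfeas hmin h.1 h.2⟩
    have hA : Aᵀ *ᵥ lam = y - (y - Aᵀ *ᵥ lam) := (sub_sub_cancel _ _).symm
    have hB : Bᵀ *ᵥ lam = -(ρ • (-(ρ⁻¹ • (Bᵀ *ᵥ lam)))) := by
      rw [smul_neg, neg_neg, smul_inv_smul₀ hρ.ne']
    obtain ⟨hf, ho⟩ := primal_optimal_of_dual_optimal hρ hA hB hlam h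
    obtain ⟨e1, e2⟩ := huniq _ _ hf ho
    rw [e1] at hA
    rw [e2] at hB
    exact ⟨hA, hB⟩
  exact ⟨main, Set.ext fun lam => and_congr_right fun hlam => main lam hlam⟩
end

section
/- Let 1 ≤ K ≤ M ≤ N, let π(l) = (Σ_{k=1}^{K} C(l−1,k−1)·C(N−l,M−k))/C(N,M) for 1 ≤ l ≤ N, and let θ ∈ ℝ^N satisfy |θ_1| ≥ |θ_2| ≥ … ≥ |θ_N|. Then π is nonincreasing in l with π(l) ≤ M/N for every l, and (K/N)·Σ_{l=1}^N θ_l² ≤ Σ_{l=1}^N π(l)·θ_l² ≤ (M/N)·Σ_{l=1}^N θ_l². -/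
open Finset

/-- The selection probability of the element of rank `l` under the random-then-greedy rule:
`π(l) = (Σ_{k=1}^{K} C(l−1,k−1)·C(N−l,M−k))/C(N,M)`. -/
noncomputable def rtgProb (N M K l : ℕ) : ℝ :=
  (∑ k ∈ Finset.Icc 1 K,
    ((Nat.choose (l - 1) (k - 1) * Nat.choose (N - l) (M - k) : ℕ) : ℝ)) /
    (Nat.choose N M : ℝ)

theorem sum_antidiagonal_choose_mul_choose (n a b : ℕ) :
    ∑ p ∈ antidiagonal n, p.1.choose a * p.2.choose b = (n + 1).choose (a + b + 1) := by
  induction n generalizing a b with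
  | zero => cases a <;> cases b <;> simp [Nat.choose_eq_zero_of_lt]
  | succ n ih =>
    rw [Finset.Nat.sum_antidiagonal_succ]
    cases a with
    | zero =>
      have h := ih 0 b
      simp only [Nat.choose_zero_right, one_mul, zero_add] at h ⊢
      rw [h, Nat.choose_succ_succ (n + 1) b]
    | succ a =>
      simp only [Nat.choose_zero_succ, zero_mul, zero_add, Nat.choose_succ_succ _ a, add_mul,
        sum_add_distrib, ih]
      rw [show a + 1 + b + 1 = (a + b + 1) + 1 by ring, Nat.choose_succ_succ (n + 1)]

theorem sum_range_choose_mul_choose (i r m : ℕ) :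
    ∑ j ∈ range (m + 1), i.choose j * r.choose (m - j) = (i + r).choose m := by
  rw [Nat.add_choose_eq, Finset.Nat.sum_antidiagonal_eq_sum_range_succ_mk]

theorem sum_range_choose_mul_choose_succ_le (i r m q : ℕ) (hq : q ≤ m) :
    ∑ j ∈ range (q + 1), (i + 1).choose j * r.choose (m - j) ≤
      ∑ j ∈ range (q + 1), i.choose j * (r + 1).choose (m - j) := by
  have hleft : ∑ j ∈ range (q + 1), (i + 1).choose j * r.choose (m - j) =
      ∑ j ∈ range q, i.choose j * r.choose (m - (j + 1)) +
        ∑ j ∈ range (q + 1), i.choose j * r.choose (m - j) := by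
    rw [sum_range_succ', sum_range_succ' (fun j => i.choose j * r.choose (m - j))]
    simp only [Nat.choose_succ_succ, add_mul, sum_add_distrib, Nat.choose_zero_right]
    ring
  rw [hleft, sum_range_succ, sum_range_succ, ← add_assoc, ← sum_add_distrib]
  refine add_le_add (sum_le_sum fun j hj => ?_)
    (Nat.mul_le_mul_left _ (Nat.choose_le_choose _ r.le_succ))
  obtain ⟨d, hd⟩ : ∃ d, m - j = d + 1 := ⟨m - j - 1, by have := mem_range.1 hj; omega⟩
  rw [show m - (j + 1) = d by omega, hd, Nat.choose_succ_succ r d, mul_add]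

theorem rtgProb_succ (n m K i : ℕ) :
    rtgProb (n + 1) (m + 1) K (i + 1) =
      ((∑ j ∈ range K, i.choose j * (n - i).choose (m - j) : ℕ) : ℝ) /
        ((n + 1).choose (m + 1) : ℝ) := by
  have hIcc : Icc 1 K = Ico (0 + 1) (K + 1) := rfl
  rw [rtgProb, ← Nat.cast_sum, hIcc, ← sum_Ico_add' _ 0 K 1, ← range_eq_Ico]
  simp

theorem rtgProb_succ_le {N M K l : ℕ} (hK : 1 ≤ K) (hKM : K ≤ M) (hl : 1 ≤ l)
    (hlN : l + 1 ≤ N) : rtgProb N M K (l + 1) ≤ rtgProb N M K l := by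
  obtain ⟨q, rfl⟩ := Nat.exists_eq_add_of_le' hK
  obtain ⟨m, rfl⟩ := Nat.exists_eq_add_of_le' (hK.trans hKM)
  obtain ⟨i, rfl⟩ := Nat.exists_eq_add_of_le' hl
  obtain ⟨r, rfl⟩ := Nat.exists_eq_add_of_le' hlN
  rw [show r + (i + 1 + 1) = (r + i + 1) + 1 by ring, rtgProb_succ, rtgProb_succ,
    show r + i + 1 - (i + 1) = r by omega, show r + i + 1 - i = r + 1 by omega]
  exact div_le_div_of_nonneg_right (Nat.cast_le.2
    (sum_range_choose_mul_choose_succ_le i r m q (by omega))) (Nat.cast_nonneg _)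

theorem rtgProb_le {N M K l : ℕ} (hK : 1 ≤ K) (hKM : K ≤ M) (hMN : M ≤ N) (hl : 1 ≤ l)
    (hlN : l ≤ N) : rtgProb N M K l ≤ (M : ℝ) / (N : ℝ) := by
  obtain ⟨m, rfl⟩ := Nat.exists_eq_add_of_le' (hK.trans hKM)
  obtain ⟨i, rfl⟩ := Nat.exists_eq_add_of_le' hl
  obtain ⟨n, rfl⟩ := Nat.exists_eq_add_of_le' (hl.trans hlN)
  have hsum : ∑ j ∈ range K, i.choose j * (n - i).choose (m - j) ≤ n.choose m := by
    calc _ ≤ ∑ j ∈ range (m + 1), i.choose j * (n - i).choose (m - j) :=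
          sum_le_sum_of_subset (range_subset_range.2 hKM)
      _ = _ := by rw [sum_range_choose_mul_choose, Nat.add_sub_cancel' (by omega)]
  rw [rtgProb_succ, div_le_div_iff₀ (by exact_mod_cast Nat.choose_pos hMN) (by positivity)]
  norm_cast
  calc _ ≤ n.choose m * (n + 1) := Nat.mul_le_mul_right _ hsum
    _ = _ := by rw [mul_comm, Nat.add_one_mul_choose_eq, mul_comm]

theorem sum_rtgProb {N M K : ℕ} (hK : 1 ≤ K) (hKM : K ≤ M) (hMN : M ≤ N) :
    ∑ l ∈ Icc 1 N, rtgProb N M K l = K := by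
  obtain ⟨m, rfl⟩ := Nat.exists_eq_add_of_le' (hK.trans hKM)
  obtain ⟨n, rfl⟩ := Nat.exists_eq_add_of_le' (hK.trans (hKM.trans hMN))
  have hpos : (0 : ℝ) < ((n + 1).choose (m + 1) : ℝ) := by exact_mod_cast Nat.choose_pos hMN
  have hIcc : Icc 1 (n + 1) = Ico (0 + 1) (n + 1 + 1) := rfl
  rw [hIcc, ← sum_Ico_add' (rtgProb (n + 1) (m + 1) K) 0 (n + 1) 1, ← range_eq_Ico]
  simp only [rtgProb_succ]
  rw [← sum_div, div_eq_iff hpos.ne']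
  norm_cast
  rw [sum_comm, sum_congr rfl (g := fun _ => (n + 1).choose (m + 1)) fun j hj => ?_]
  · simp
  · rw [← Finset.Nat.sum_antidiagonal_eq_sum_range_succ
      (fun a b => a.choose j * b.choose (m - j)), sum_antidiagonal_choose_mul_choose]
    congr 2
    have := mem_range.1 hj
    omega

theorem antitoneOn_Icc_of_succ_le {f : ℕ → ℝ} {N : ℕ}
    (hf : ∀ l, 1 ≤ l → l + 1 ≤ N → f (l + 1) ≤ f l) : AntitoneOn f (Icc 1 N : Finset ℕ) := by
  rw [coe_Icc]
  exact antitoneOn_of_succ_le Set.ordConnected_Icc fun l _ hl hl' => hf l hl.1 hl'.2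

/-- For `1 ≤ K ≤ M ≤ N` and `θ` with `|θ₁| ≥ … ≥ |θ_N|`: `π` is nonincreasing with
`π(l) ≤ M/N`, and `(K/N)·Σ θ_l² ≤ Σ π(l)·θ_l² ≤ (M/N)·Σ θ_l²`. -/
theorem stmt8 (N M K : ℕ) (hK : 1 ≤ K) (hKM : K ≤ M) (hMN : M ≤ N)
    (θ : ℕ → ℝ) (hθ : ∀ l, 1 ≤ l → l + 1 ≤ N → |θ (l + 1)| ≤ |θ l|) :
    (∀ l, 1 ≤ l → l + 1 ≤ N → rtgProb N M K (l + 1) ≤ rtgProb N M K l) ∧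
    (∀ l, 1 ≤ l → l ≤ N → rtgProb N M K l ≤ (M : ℝ) / (N : ℝ)) ∧
    ((K : ℝ) / (N : ℝ) * ∑ l ∈ Finset.Icc 1 N, θ l ^ 2 ≤
      ∑ l ∈ Finset.Icc 1 N, rtgProb N M K l * θ l ^ 2) ∧
    (∑ l ∈ Finset.Icc 1 N, rtgProb N M K l * θ l ^ 2 ≤
      (M : ℝ) / (N : ℝ) * ∑ l ∈ Finset.Icc 1 N, θ l ^ 2) := by
  have hanti : AntitoneOn (rtgProb N M K) (Icc 1 N : Finset ℕ) :=
    antitoneOn_Icc_of_succ_le fun l => rtgProb_succ_le hK hKM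
  have hsq : AntitoneOn (fun l => θ l ^ 2) (Icc 1 N : Finset ℕ) :=
    antitoneOn_Icc_of_succ_le fun l hl hlN => sq_le_sq.2 (hθ l hl hlN)
  have hN : (0 : ℝ) < N := by exact_mod_cast hK.trans (hKM.trans hMN)
  refine ⟨fun l => rtgProb_succ_le hK hKM, fun l => rtgProb_le hK hKM hMN, ?_, ?_⟩
  · have h := (hanti.monovaryOn hsq).sum_mul_sum_le_card_mul_sum
    rw [sum_rtgProb hK hKM hMN, Nat.card_Icc, Nat.add_sub_cancel] at h
    rwa [div_mul_eq_mul_div, div_le_iff₀' hN]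
  · rw [mul_sum]
    refine sum_le_sum fun l hl => mul_le_mul_of_nonneg_right ?_ (sq_nonneg _)
    exact rtgProb_le hK hKM hMN (mem_Icc.1 hl).1 (mem_Icc.1 hl).2
end

section
/- (Hoffman's lemma for systems with sign constraints.) Let D ∈ ℝ^{q×N}. There exists a constant μ_D > 0, depending only on D, such that for every s ∈ ℝ^q for which the polyhedron Λ_s = { λ ∈ ℝ^N : Dλ = s, λ ≤ 0 componentwise } is nonempty, and for every λ ∈ ℝ^N with λ ≤ 0 componentwise, there exists λ₀ ∈ Λ_s with ‖Dλ − s‖² ≥ μ_D · ‖λ − λ₀‖². -/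
open Matrix Finset

/-- The closed orthant face of vectors whose signs are compatible with the sign vector `σ`. -/
def signCone {n : Type*} (σ : n → SignType) : Set (n → ℝ) :=
  {z | ∀ i, (σ i = 0 → z i = 0) ∧ 0 ≤ (σ i : ℝ) * z i}

lemma isClosed_signCone {n : Type*} (σ : n → SignType) : IsClosed (signCone σ) := by
  have : signCone σ = ⋂ i, {z : n → ℝ | σ i = 0 → z i = 0} ∩ {z | 0 ≤ (σ i : ℝ) * z i} := by
    ext z
    simp [signCone]
  rw [this]
  refine isClosed_iInter fun i => IsClosed.inter ?_ ?_
  · by_cases h : σ i = 0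
    · simpa [h] using isClosed_eq (continuous_apply i) continuous_const
    · simp [h]
  · exact isClosed_le continuous_const (by fun_prop)

lemma smul_mem_signCone {n : Type*} {σ : n → SignType} {z : n → ℝ} (hz : z ∈ signCone σ)
    {t : ℝ} (ht : 0 ≤ t) : t • z ∈ signCone σ := by
  intro i
  obtain ⟨h0, h1⟩ := hz i
  refine ⟨fun h => by simp [h0 h], ?_⟩
  have := mul_nonneg ht h1
  simp only [Pi.smul_apply, smul_eq_mul]
  linarith

lemma exists_pos_forall_le {ι : Type*} [Finite ι] (c : ι → ℝ) (hc : ∀ i, 0 < c i) :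
    ∃ m : ℝ, 0 < m ∧ ∀ i, m ≤ c i := by
  cases isEmpty_or_nonempty ι
  · exact ⟨1, one_pos, fun i => isEmptyElim i⟩
  · obtain ⟨i, hi⟩ := Finite.exists_min c
    exact ⟨c i, hc i, hi⟩

/-- A matrix whose kernel meets a closed cone trivially is bounded below on this cone. -/
lemma exists_pos_mul_sum_sq_le {m n : Type*} [Fintype m] [Fintype n] (D : Matrix m n ℝ)
    {K : Set (n → ℝ)} (hK : IsClosed K)
    (hsmul : ∀ z ∈ K, ∀ t : ℝ, 0 ≤ t → t • z ∈ K)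
    (hker : ∀ z ∈ K, D.mulVec z = 0 → z = 0) :
    ∃ c : ℝ, 0 < c ∧ ∀ z ∈ K, c * ∑ i, z i ^ 2 ≤ ∑ j, (D.mulVec z j) ^ 2 := by
  have hsphere : IsCompact {z : n → ℝ | ∑ i, z i ^ 2 = 1} := by
    refine (isCompact_univ_pi fun _ : n => isCompact_Icc (a := (-1 : ℝ)) (b := 1)).of_isClosed_subset
      (isClosed_eq (by fun_prop) continuous_const) ?_
    intro z hz i _
    have hle : z i ^ 2 ≤ 1 := by
      rw [← show ∑ i, z i ^ 2 = 1 from hz]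
      exact Finset.single_le_sum (f := fun i => z i ^ 2) (fun _ _ => sq_nonneg _)
        (Finset.mem_univ i)
    exact abs_le.mp ((sq_le_one_iff_abs_le_one _).mp hle)
  have hcont : Continuous fun z : n → ℝ => ∑ j, (D.mulVec z j) ^ 2 := by
    unfold Matrix.mulVec dotProduct
    fun_prop
  have hbound : ∃ c : ℝ, 0 < c ∧
      ∀ z ∈ {z : n → ℝ | ∑ i, z i ^ 2 = 1} ∩ K, c ≤ ∑ j, (D.mulVec z j) ^ 2 := by
    rcases ({z : n → ℝ | ∑ i, z i ^ 2 = 1} ∩ K).eq_empty_or_nonempty with he | hne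
    · exact ⟨1, one_pos, by simp [he]⟩
    obtain ⟨w, ⟨hw1, hwK⟩, hmin⟩ :=
      (hsphere.inter_right hK).exists_isMinOn hne hcont.continuousOn
    refine ⟨∑ j, (D.mulVec w j) ^ 2, ?_, fun z hz => hmin hz⟩
    refine (Finset.sum_nonneg fun _ _ => sq_nonneg _).lt_of_ne' fun h0 => ?_
    have hDw : D.mulVec w = 0 := by
      ext j
      simpa using (Finset.sum_eq_zero_iff_of_nonneg fun _ _ => sq_nonneg _).mp h0 j
        (Finset.mem_univ j)
    simp [hker w hwK hDw] at hw1
  obtain ⟨c, hc, hcle⟩ := hbound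
  refine ⟨c, hc, fun z hz => ?_⟩
  have hg : 0 ≤ ∑ i, z i ^ 2 := Finset.sum_nonneg fun _ _ => sq_nonneg _
  rcases hg.eq_or_lt with h0 | hpos
  · rw [← h0, mul_zero]
    exact Finset.sum_nonneg fun _ _ => sq_nonneg _
  have hsq : ((√(∑ i, z i ^ 2))⁻¹) ^ 2 = (∑ i, z i ^ 2)⁻¹ := by
    rw [inv_pow, Real.sq_sqrt hg]
  have key := hcle ((√(∑ i, z i ^ 2))⁻¹ • z) ⟨by
    simp only [Set.mem_ofPred_eq, Pi.smul_apply, smul_eq_mul, mul_pow, ← Finset.mul_sum, hsq]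
    exact inv_mul_cancel₀ hpos.ne', hsmul z hz _ (by positivity)⟩
  simp only [Matrix.mulVec_smul, Pi.smul_apply, smul_eq_mul, mul_pow, ← Finset.mul_sum,
    hsq] at key
  rwa [inv_mul_eq_div, le_div_iff₀ hpos] at key

/-- A kernel vector sign-compatible with `y` can be subtracted from `y`, after scaling, without
leaving the box spanned by `0` and `y`, which decreases the `ℓ¹`-norm. -/
lemma exists_smaller_of_mem_signCone {n : Type*} [Fintype n] {y z : n → ℝ}
    (hz : z ∈ signCone fun i => SignType.sign (y i)) (hz0 : z ≠ 0) :
    ∃ t : ℝ, (∀ i, (y - t • z) i ∈ Set.uIcc 0 (y i)) ∧ ∑ i, |(y - t • z) i| < ∑ i, |y i| := by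
  have hstep : ∀ i, ∃ t : ℝ, 0 < t ∧ t * |z i| ≤ |y i| := fun i => by
    by_cases h : z i = 0
    · exact ⟨1, one_pos, by simp [h]⟩
    · have hy : y i ≠ 0 := fun h' => h ((hz i).1 (by simp [h']))
      exact ⟨|y i| / |z i|, by positivity, by rw [div_mul_cancel₀ _ (abs_ne_zero.mpr h)]⟩
  choose t ht htz using hstep
  obtain ⟨m, hm, hmt⟩ := exists_pos_forall_le t ht
  have hmz : ∀ i, m * |z i| ≤ |y i| := fun i =>
    (mul_le_mul_of_nonneg_right (hmt i) (abs_nonneg _)).trans (htz i)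
  have hcoord : ∀ i, (y - m • z) i ∈ Set.uIcc 0 (y i) ∧ |(y - m • z) i| = |y i| - m * |z i| := by
    intro i
    obtain ⟨h0, h1⟩ := hz i
    have hmi := hmz i
    simp only [Pi.sub_apply, Pi.smul_apply, smul_eq_mul]
    rcases lt_trichotomy (y i) 0 with h | h | h
    · have hzi : z i ≤ 0 := by simpa [sign_neg h] using h1
      rw [abs_of_neg h, abs_of_nonpos hzi] at hmi ⊢
      have := mul_nonneg hm.le (neg_nonneg.mpr hzi)
      rw [Set.uIcc_of_ge h.le, abs_of_nonpos (by linarith)]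
      exact ⟨⟨by linarith, by linarith⟩, by ring⟩
    · simp [h, h0 (by simp [h])]
    · have hzi : 0 ≤ z i := by simpa [sign_pos h] using h1
      rw [abs_of_pos h, abs_of_nonneg hzi] at hmi ⊢
      have := mul_nonneg hm.le hzi
      rw [Set.uIcc_of_le h.le, abs_of_nonneg (by linarith)]
      exact ⟨⟨by linarith, by linarith⟩, rfl⟩
  refine ⟨m, fun i => (hcoord i).1, ?_⟩
  obtain ⟨i, hi⟩ := Function.ne_iff.mp hz0
  refine Finset.sum_lt_sum (fun i _ => ?_) ⟨i, Finset.mem_univ i, ?_⟩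
  · rw [(hcoord i).2]
    exact sub_le_self _ (by positivity)
  · rw [(hcoord i).2]
    exact sub_lt_self _ (mul_pos hm (abs_pos.mpr hi))

/-- Every vector `x` dominates a vector with the same image under `D` whose sign cone meets the
kernel of `D` trivially. -/
lemma exists_mem_uIcc_mulVec_eq {m n : Type*} [Fintype n] (D : Matrix m n ℝ) (x : n → ℝ) :
    ∃ y : n → ℝ, D.mulVec y = D.mulVec x ∧ (∀ i, y i ∈ Set.uIcc 0 (x i)) ∧
      ∀ z ∈ signCone fun i => SignType.sign (y i), D.mulVec z = 0 → z = 0 := by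
  have hclosed : IsClosed {y : n → ℝ | D.mulVec y = D.mulVec x} :=
    isClosed_eq (by unfold Matrix.mulVec dotProduct; fun_prop) continuous_const
  obtain ⟨y, ⟨hybox, hy⟩, hmin⟩ :=
    ((isCompact_univ_pi fun i => isCompact_uIcc (a := (0 : ℝ)) (b := x i)).inter_right
      hclosed).exists_isMinOn ⟨x, fun i _ => Set.right_mem_uIcc, rfl⟩
      (f := fun y => ∑ i, |y i|) (by fun_prop)
  refine ⟨y, hy, fun i => hybox i (Set.mem_univ i), fun z hz hDz => ?_⟩
  by_contra hz0
  obtain ⟨t, htbox, hlt⟩ := exists_smaller_of_mem_signCone hz hz0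
  refine hlt.not_ge (hmin ⟨fun i _ => ?_, ?_⟩)
  · exact Set.uIcc_subset_uIcc Set.left_mem_uIcc (hybox i (Set.mem_univ i)) (htbox i)
  · simpa [Matrix.mulVec_sub, Matrix.mulVec_smul, hDz] using hy

/-- Hoffman's lemma for systems with sign constraints: for `D ∈ ℝ^{q×N}` there exists
`μ_D > 0` such that for every `s` with `Λ_s = {λ : Dλ = s, λ ≤ 0}` nonempty and every
`λ ≤ 0`, there exists `λ₀ ∈ Λ_s` with `‖Dλ − s‖² ≥ μ_D·‖λ − λ₀‖²`. -/
theorem stmt11 (q N : ℕ) (D : Matrix (Fin q) (Fin N) ℝ) :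
    ∃ μ : ℝ, 0 < μ ∧
      ∀ s : Fin q → ℝ,
        {lam : Fin N → ℝ | D.mulVec lam = s ∧ ∀ i, lam i ≤ 0}.Nonempty →
        ∀ lam : Fin N → ℝ, (∀ i, lam i ≤ 0) →
          ∃ lam0 : Fin N → ℝ, (D.mulVec lam0 = s ∧ ∀ i, lam0 i ≤ 0) ∧
            μ * ∑ i, (lam i - lam0 i) ^ 2 ≤ ∑ j, (D.mulVec lam j - s j) ^ 2 := by
  have hσ : ∀ σ : Fin N → SignType, ∃ c : ℝ, 0 < c ∧
      ((∀ z ∈ signCone σ, D.mulVec z = 0 → z = 0) →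
        ∀ z ∈ signCone σ, c * ∑ i, z i ^ 2 ≤ ∑ j, (D.mulVec z j) ^ 2) := fun σ => by
    by_cases h : ∀ z ∈ signCone σ, D.mulVec z = 0 → z = 0
    · obtain ⟨c, hc, hle⟩ := exists_pos_mul_sum_sq_le D (isClosed_signCone σ)
        (fun z hz t ht => smul_mem_signCone hz ht) h
      exact ⟨c, hc, fun _ => hle⟩
    · exact ⟨1, one_pos, fun h' => absurd h' h⟩
  choose c hc hcle using hσ
  obtain ⟨μ, hμ, hμc⟩ := exists_pos_forall_le c hc
  refine ⟨μ, hμ, ?_⟩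
  rintro s ⟨lam', hs, hlam'⟩ lam hlam
  obtain ⟨y, hDy, hybox, hker⟩ := exists_mem_uIcc_mulVec_eq D (lam' - lam)
  rw [Matrix.mulVec_sub, hs] at hDy
  refine ⟨lam + y, ⟨by rw [Matrix.mulVec_add, hDy]; abel, fun i => ?_⟩, ?_⟩
  · have h := hybox i
    have h1 := hlam i
    have h2 := hlam' i
    rw [Pi.sub_apply, Set.mem_uIcc] at h
    rw [Pi.add_apply]
    rcases h with h | h <;> linarith [h.1, h.2]
  · have hy : y ∈ signCone fun i => SignType.sign (y i) := fun i =>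
      ⟨sign_eq_zero_iff.mp, by rw [sign_mul_self]; exact abs_nonneg _⟩
    calc μ * ∑ i, (lam i - (lam + y) i) ^ 2 = μ * ∑ i, y i ^ 2 := by simp
      _ ≤ c (fun i => SignType.sign (y i)) * ∑ i, y i ^ 2 :=
        mul_le_mul_of_nonneg_right (hμc _) (Finset.sum_nonneg fun _ _ => sq_nonneg _)
      _ ≤ ∑ j, (D.mulVec y j) ^ 2 := hcle _ hker y hy
      _ = ∑ j, (D.mulVec lam j - s j) ^ 2 := by
        simp only [hDy, Pi.sub_apply, sub_sq_comm]
end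

section
/- Let L : ℝ^N → ℝ be differentiable and σ-smooth with σ > 0, let λ ∈ ℝ^N satisfy λ ≤ 0 componentwise, and let W ⊆ {1,…,N}. Define λ⁺ by λ⁺_ω = min{0, λ_ω − (1/σ)·∂L/∂λ_ω(λ)} for ω ∈ W and λ⁺_ω = λ_ω for ω ∉ W. Then L(λ⁺) ≤ L(λ) − (1/(2σ)) · Σ_{ω∈W} d(λ_ω, ∂L/∂λ_ω(λ), σ). -/
open Finset
open scoped RealInnerProductSpace

/-- `d(λ, θ, μ) = −2μ · inf{ θ·(t − λ) + (μ/2)·(t − λ)² : t ≤ 0 }`. -/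
noncomputable def dfun (lam θ μ : ℝ) : ℝ :=
  -(2 * μ) * sInf {v : ℝ | ∃ t : ℝ, t ≤ 0 ∧ v = θ * (t - lam) + μ / 2 * (t - lam) ^ 2}

/-- A projected gradient step minimizes the quadratic model over the nonpositive half-line. -/
theorem isLeast_quadratic_model_min (lam θ : ℝ) {μ : ℝ} (hμ : 0 < μ) :
    IsLeast {v : ℝ | ∃ t : ℝ, t ≤ 0 ∧ v = θ * (t - lam) + μ / 2 * (t - lam) ^ 2}
      (θ * (min 0 (lam - 1 / μ * θ) - lam) + μ / 2 * (min 0 (lam - 1 / μ * θ) - lam) ^ 2) := by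
  refine ⟨⟨_, min_le_left _ _, rfl⟩, ?_⟩
  rintro _ ⟨t, ht, rfl⟩
  obtain ⟨q, rfl⟩ : ∃ q, θ = μ * (lam - q) := ⟨lam - 1 / μ * θ, by field_simp; ring⟩
  have hq : lam - 1 / μ * (μ * (lam - q)) = q := by field_simp; ring
  rw [hq]
  rcases le_total 0 q with h | h
  · rw [min_eq_left h]
    nlinarith [mul_nonneg hμ.le (mul_nonneg h (neg_nonneg.2 ht)),
      mul_nonneg hμ.le (sq_nonneg t)]
  · rw [min_eq_right h]
    nlinarith [mul_nonneg hμ.le (sq_nonneg (t - q))]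

theorem one_div_two_mul_mul_dfun (lam θ : ℝ) {μ : ℝ} (hμ : 0 < μ) :
    1 / (2 * μ) * dfun lam θ μ =
      -(θ * (min 0 (lam - 1 / μ * θ) - lam) + μ / 2 * (min 0 (lam - 1 / μ * θ) - lam) ^ 2) := by
  rw [dfun, (isLeast_quadratic_model_min lam θ hμ).csInf_eq]
  field_simp

/-- Descent lemma for a projected gradient step over a subset `W` of coordinates:
if `L` is differentiable with gradient `g` and `σ`-smooth, `λ ≤ 0`, and `λ⁺` is obtained from
`λ` by `λ⁺_ω = min{0, λ_ω − (1/σ)·∂L/∂λ_ω(λ)}` for `ω ∈ W` and `λ⁺_ω = λ_ω` otherwise, then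
`L(λ⁺) ≤ L(λ) − (1/(2σ)) Σ_{ω∈W} d(λ_ω, ∂L/∂λ_ω(λ), σ)`. -/
theorem stmt13 (N : ℕ) (σ : ℝ) (hσ : 0 < σ)
    (L : EuclideanSpace ℝ (Fin N) → ℝ)
    (g : EuclideanSpace ℝ (Fin N) → EuclideanSpace ℝ (Fin N))
    (hgrad : ∀ x, HasGradientAt L (g x) x)
    (hsmooth : ∀ a b : EuclideanSpace ℝ (Fin N),
      L b ≤ L a + ⟪g a, b - a⟫ + σ / 2 * ‖b - a‖ ^ 2)
    (lam : EuclideanSpace ℝ (Fin N)) (hlam : ∀ ω, lam ω ≤ 0)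
    (W : Finset (Fin N))
    (lamPlus : EuclideanSpace ℝ (Fin N))
    (hPlusW : ∀ ω ∈ W, lamPlus ω = min 0 (lam ω - (1 / σ) * g lam ω))
    (hPlusNotW : ∀ ω ∉ W, lamPlus ω = lam ω) :
    L lamPlus ≤ L lam - (1 / (2 * σ)) * ∑ ω ∈ W, dfun (lam ω) (g lam ω) σ := by
  have hmodel : ⟪g lam, lamPlus - lam⟫ + σ / 2 * ‖lamPlus - lam‖ ^ 2 =
      ∑ ω ∈ W, (g lam ω * (lamPlus ω - lam ω) + σ / 2 * (lamPlus ω - lam ω) ^ 2) := by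
    rw [EuclideanSpace.real_norm_sq_eq, PiLp.inner_apply, Finset.mul_sum,
      ← Finset.sum_add_distrib]
    symm
    refine (Finset.sum_subset (Finset.subset_univ W) fun ω _ hω => ?_).trans
      (Finset.sum_congr rfl fun ω _ => ?_)
    · simp [hPlusNotW ω hω]
    · simp [mul_comm]
  have hd : 1 / (2 * σ) * ∑ ω ∈ W, dfun (lam ω) (g lam ω) σ =
      -∑ ω ∈ W, (g lam ω * (lamPlus ω - lam ω) + σ / 2 * (lamPlus ω - lam ω) ^ 2) := by
    rw [Finset.mul_sum, ← Finset.sum_neg_distrib]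
    refine Finset.sum_congr rfl fun ω hω => ?_
    rw [one_div_two_mul_mul_dfun _ _ hσ, hPlusW ω hω]
  linarith [hsmooth lam lamPlus]
end

section
/- Let L : ℝ^N → ℝ be convex, differentiable, and σ-smooth with σ > 0. Let W ⊆ W' ⊆ {1,…,N}, suppose λ minimizes L over Λ_W and λ' minimizes L over Λ_{W'}. Then L(λ') ≤ L(λ) − (1/(2σ)) · Σ_{ω ∈ W'\W} (max{∂L/∂λ_ω(λ), 0})². -/
open Finset
open scoped RealInnerProductSpace

/-- Exact minimization over nested active sets: if `L` is convex, differentiable (with gradient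
`g`) and `σ`-smooth, `W ⊆ W'`, `λ` minimizes `L` over `Λ_W` and `λ'` minimizes `L` over
`Λ_{W'}`, then `L(λ') ≤ L(λ) − (1/(2σ)) Σ_{ω ∈ W'\W} (max{∂L/∂λ_ω(λ), 0})²`. -/
theorem stmt14 (N : ℕ) (σ : ℝ) (hσ : 0 < σ)
    (L : EuclideanSpace ℝ (Fin N) → ℝ)
    (g : EuclideanSpace ℝ (Fin N) → EuclideanSpace ℝ (Fin N))
    (hconv : ConvexOn ℝ Set.univ L)
    (hgrad : ∀ x, HasGradientAt L (g x) x)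
    (hsmooth : ∀ a b : EuclideanSpace ℝ (Fin N),
      L b ≤ L a + ⟪g a, b - a⟫ + σ / 2 * ‖b - a‖ ^ 2)
    (W W' : Finset (Fin N)) (hWW' : W ⊆ W')
    (lam lam' : EuclideanSpace ℝ (Fin N))
    (hlamMem : (∀ ω, lam ω ≤ 0) ∧ ∀ ω ∉ W, lam ω = 0)
    (hlamMin : ∀ z : EuclideanSpace ℝ (Fin N),
      (∀ ω, z ω ≤ 0) → (∀ ω ∉ W, z ω = 0) → L lam ≤ L z)
    (hlam'Mem : (∀ ω, lam' ω ≤ 0) ∧ ∀ ω ∉ W', lam' ω = 0)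
    (hlam'Min : ∀ z : EuclideanSpace ℝ (Fin N),
      (∀ ω, z ω ≤ 0) → (∀ ω ∉ W', z ω = 0) → L lam' ≤ L z) :
    L lam' ≤ L lam - (1 / (2 * σ)) * ∑ ω ∈ W' \ W, (max (g lam ω) 0) ^ 2 := by
  let d : EuclideanSpace ℝ (Fin N) := WithLp.toLp 2 fun ω =>
    if ω ∈ W' \ W then -(1 / σ) * max (g lam ω) 0 else 0
  have hd_apply (ω : Fin N) :
      d ω = if ω ∈ W' \ W then -(1 / σ) * max (g lam ω) 0 else 0 := rfl
  have hd_nonpos (ω : Fin N) : d ω ≤ 0 := by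
    have : 0 ≤ 1 / σ * max (g lam ω) 0 := by positivity
    rw [hd_apply]
    split_ifs <;> linarith
  have hmin : L lam' ≤ L (lam + d) := by
    refine hlam'Min _ (fun ω => add_nonpos (hlamMem.1 ω) (hd_nonpos ω)) fun ω hω => ?_
    have hdω : d ω = 0 := by
      rw [hd_apply, if_neg fun h => hω (mem_sdiff.1 h).1]
    rw [PiLp.add_apply, hdω, hlamMem.2 ω fun h => hω (hWW' h), add_zero]
  have hinner : ⟪g lam, d⟫ = -(1 / σ) * ∑ ω ∈ W' \ W, (max (g lam ω) 0) ^ 2 := by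
    rw [PiLp.inner_apply, mul_sum, ← Fintype.sum_ite_mem (W' \ W)]
    refine sum_congr rfl fun ω _ => ?_
    rw [hd_apply]
    split_ifs
    · rcases max_cases (g lam ω) 0 with h | h
      · simp only [h.1, RCLike.inner_apply, conj_trivial]
        ring
      · simp [h.1]
    · simp
  have hnorm : ‖d‖ ^ 2 = (1 / σ) ^ 2 * ∑ ω ∈ W' \ W, (max (g lam ω) 0) ^ 2 := by
    rw [EuclideanSpace.real_norm_sq_eq, mul_sum, ← Fintype.sum_ite_mem (W' \ W)]
    refine sum_congr rfl fun ω _ => ?_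
    rw [hd_apply]
    split_ifs <;> ring
  have hstep := hsmooth lam (lam + d)
  rw [add_sub_cancel_left, hinner, hnorm] at hstep
  refine (hmin.trans hstep).trans_eq ?_
  field_simp
  ring
end

section
/- (Exact active-set step: per-iteration linear progress.) Let L : ℝ^N → ℝ be convex, differentiable, and σ-smooth, attaining its minimum value L* over { λ ∈ ℝ^N : λ ≤ 0 }. Suppose there is μ > 0 such that for all λ ≤ 0: L(λ) − L* ≤ (1/(2μ)) · Σ_{ω=1}^N d(λ_ω, ∂L/∂λ_ω(λ), μ). Let W ⊆ W' ⊆ {1,…,N}, let λ minimize L over Λ_W and λ' minimize L over Λ_{W'}, and suppose α ≥ 1 satisfies α · Σ_{ω ∈ W'\W} (max{∂L/∂λ_ω(λ), 0})² ≥ Σ_{ω ∉ W} (max{∂L/∂λ_ω(λ), 0})². Then L(λ') − L* ≤ (1 − μ/(α·σ)) · (L(λ) − L*). -/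
open Finset
open scoped RealInnerProductSpace

/-- The proximal quantity `d` is nonpositive at a point where no feasible move is a
first-order descent direction. -/
theorem dfun_nonpos {x θ μ : ℝ} (hμ : 0 < μ) (h : ∀ t ≤ 0, 0 ≤ θ * (t - x)) :
    dfun x θ μ ≤ 0 := by
  have : 0 ≤ sInf {v : ℝ | ∃ t : ℝ, t ≤ 0 ∧ v = θ * (t - x) + μ / 2 * (t - x) ^ 2} := by
    apply Real.sInf_nonneg
    rintro v ⟨t, ht, rfl⟩
    have := h t ht
    positivity
  unfold dfun
  nlinarith [mul_nonneg hμ.le this]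

/-- At the boundary point `0`, the proximal quantity `d` is at most the squared positive part
of the derivative. -/
theorem dfun_zero_le {θ μ : ℝ} (hμ : 0 < μ) : dfun 0 θ μ ≤ (max θ 0) ^ 2 := by
  have : -(max θ 0) ^ 2 / (2 * μ) ≤
      sInf {v : ℝ | ∃ t : ℝ, t ≤ 0 ∧ v = θ * (t - 0) + μ / 2 * (t - 0) ^ 2} := by
    refine le_csInf ⟨_, 0, le_rfl, rfl⟩ ?_
    rintro v ⟨t, ht, rfl⟩
    rw [div_le_iff₀ (by positivity)]
    have h : 0 ≤ (θ - max θ 0) * t :=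
      mul_nonneg_of_nonpos_of_nonpos (sub_nonpos.2 (le_max_left _ _)) ht
    nlinarith [sq_nonneg (max θ 0 + μ * t), mul_nonneg hμ.le h]
  rw [div_le_iff₀ (by positivity)] at this
  unfold dfun
  linarith

/-- First-order optimality in one coordinate: if moving the coordinate `ω` of `x` towards `t`
does not decrease a smooth function, then the directional derivative is nonnegative. -/
theorem partial_mul_sub_nonneg {N : ℕ} {σ : ℝ} (hσ : 0 < σ)
    {L : EuclideanSpace ℝ (Fin N) → ℝ} {x v : EuclideanSpace ℝ (Fin N)}
    (hsmooth : ∀ b : EuclideanSpace ℝ (Fin N),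
      L b ≤ L x + ⟪v, b - x⟫ + σ / 2 * ‖b - x‖ ^ 2)
    (ω : Fin N) (δ : ℝ)
    (hmin : ∀ s : ℝ, 0 ≤ s → s ≤ 1 → L x ≤ L (x + EuclideanSpace.single ω (s * δ))) :
    0 ≤ v ω * δ := by
  by_contra! hp
  set p := v ω * δ with hp_def
  have hD : 0 ≤ σ * δ ^ 2 := by positivity
  have hDp : 0 < σ * δ ^ 2 - p := by linarith
  set s := -p / (σ * δ ^ 2 - p) with hs_def
  have hs : 0 < s := div_pos (by linarith) hDp
  have hs1 : s ≤ 1 := by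
    rw [hs_def, div_le_one hDp]
    linarith
  have hsp : s * (σ * δ ^ 2 - p) = -p := div_mul_cancel₀ _ hDp.ne'
  have h1 := hmin s hs.le hs1
  have h2 := hsmooth (x + EuclideanSpace.single ω (s * δ))
  rw [add_sub_cancel_left, EuclideanSpace.inner_single_right, PiLp.norm_single,
    Real.norm_eq_abs, sq_abs] at h2
  simp only [conj_trivial] at h2
  have h3 : 0 ≤ s * (p + σ / 2 * s * δ ^ 2) := by
    rw [hp_def]
    linarith
  have h4 : 0 ≤ p + σ / 2 * s * δ ^ 2 := nonneg_of_mul_nonneg_right h3 hs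
  nlinarith [mul_pos hs (neg_pos.2 hp)]

/-- Exact active-set step, per-iteration linear progress: under convexity, `σ`-smoothness,
attainment of the minimum `L*` over the nonpositive orthant, the proximal-PL inequality with
constant `μ > 0`, exact minimization of `L` over `Λ_W` (at `λ`) and over `Λ_{W'}` (at `λ'`)
with `W ⊆ W'`, and the augmentation condition with constant `α ≥ 1`, one has
`L(λ') − L* ≤ (1 − μ/(α·σ))·(L(λ) − L*)`. -/
theorem stmt15 (N : ℕ) (σ : ℝ) (hσ : 0 < σ)
    (L : EuclideanSpace ℝ (Fin N) → ℝ)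
    (g : EuclideanSpace ℝ (Fin N) → EuclideanSpace ℝ (Fin N))
    (hconv : ConvexOn ℝ Set.univ L)
    (hgrad : ∀ x, HasGradientAt L (g x) x)
    (hsmooth : ∀ a b : EuclideanSpace ℝ (Fin N),
      L b ≤ L a + ⟪g a, b - a⟫ + σ / 2 * ‖b - a‖ ^ 2)
    (Lstar : ℝ)
    (hattain : ∃ z : EuclideanSpace ℝ (Fin N), (∀ ω, z ω ≤ 0) ∧ L z = Lstar)
    (hlb : ∀ z : EuclideanSpace ℝ (Fin N), (∀ ω, z ω ≤ 0) → Lstar ≤ L z)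
    (μ : ℝ) (hμ : 0 < μ)
    (hPL : ∀ z : EuclideanSpace ℝ (Fin N), (∀ ω, z ω ≤ 0) →
      L z - Lstar ≤ (1 / (2 * μ)) * ∑ ω, dfun (z ω) (g z ω) μ)
    (W W' : Finset (Fin N)) (hWW' : W ⊆ W')
    (lam lam' : EuclideanSpace ℝ (Fin N))
    (hlamMem : (∀ ω, lam ω ≤ 0) ∧ ∀ ω ∉ W, lam ω = 0)
    (hlamMin : ∀ z : EuclideanSpace ℝ (Fin N),
      (∀ ω, z ω ≤ 0) → (∀ ω ∉ W, z ω = 0) → L lam ≤ L z)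
    (hlam'Mem : (∀ ω, lam' ω ≤ 0) ∧ ∀ ω ∉ W', lam' ω = 0)
    (hlam'Min : ∀ z : EuclideanSpace ℝ (Fin N),
      (∀ ω, z ω ≤ 0) → (∀ ω ∉ W', z ω = 0) → L lam' ≤ L z)
    (α : ℝ) (hα : 1 ≤ α)
    (haug : α * ∑ ω ∈ W' \ W, (max (g lam ω) 0) ^ 2 ≥
      ∑ ω ∈ Wᶜ, (max (g lam ω) 0) ^ 2) :
    L lam' - Lstar ≤ (1 - μ / (α * σ)) * (L lam - Lstar) := by
  have hW : ∀ ω ∈ W, dfun (lam ω) (g lam ω) μ ≤ 0 := by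
    intro ω hω
    refine dfun_nonpos hμ fun t ht => ?_
    refine partial_mul_sub_nonneg hσ (hsmooth lam) ω _ fun s hs hs1 => hlamMin _ ?_ ?_
    · intro i
      have hi := hlamMem.1 i
      by_cases h : i = ω
      · subst h
        simp only [PiLp.add_apply, PiLp.single_apply, if_true]
        nlinarith [mul_nonneg hs (neg_nonneg.2 ht), mul_nonneg (sub_nonneg.2 hs1) (neg_nonneg.2 hi)]
      · simpa [h] using hi
    · intro i hi
      have h : i ≠ ω := fun h => hi (h ▸ hω)
      simpa [h] using hlamMem.2 i hi
  have hWc : ∀ ω ∈ Wᶜ, dfun (lam ω) (g lam ω) μ ≤ (max (g lam ω) 0) ^ 2 := by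
    intro ω hω
    rw [hlamMem.2 ω (mem_compl.1 hω)]
    exact dfun_zero_le hμ
  set S := ∑ ω ∈ W' \ W, (max (g lam ω) 0) ^ 2 with hS
  have hgap : L lam - Lstar ≤ 1 / (2 * μ) * (α * S) := by
    refine (hPL lam hlamMem.1).trans (mul_le_mul_of_nonneg_left ?_ (by positivity))
    rw [← sum_add_sum_compl W]
    linarith [sum_nonpos hW, sum_le_sum hWc]
  have hstep : L lam' ≤ L lam - S / (2 * σ) := by
    set u : EuclideanSpace ℝ (Fin N) :=
      WithLp.toLp 2 fun ω => if ω ∈ W' \ W then -(max (g lam ω) 0 / σ) else 0 with hu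
    have huω : ∀ ω, u ω = if ω ∈ W' \ W then -(max (g lam ω) 0 / σ) else 0 := fun _ => rfl
    have hle : L lam' ≤ L (lam + u) := by
      apply hlam'Min
      · intro ω
        have h : u ω ≤ 0 := by
          rw [huω]
          split_ifs
          · exact neg_nonpos.2 (by positivity)
          · exact le_rfl
        exact add_nonpos (hlamMem.1 ω) h
      · intro ω hω
        simp [huω, hω, hlamMem.2 ω fun h => hω (hWW' h)]
    have hs := hsmooth lam (lam + u)
    rw [add_sub_cancel_left] at hs
    have hinner : ⟪g lam, u⟫ = -(S / σ) := by
      rw [PiLp.inner_apply, hS, sum_div, ← sum_neg_distrib, ← sum_subset (subset_univ (W' \ W))]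
      · refine sum_congr rfl fun ω hω => ?_
        rw [huω, if_pos hω]
        rcases max_cases (g lam ω) 0 with ⟨h, -⟩ | ⟨h, -⟩
        · simp [h]
          ring
        · simp [h]
      · intro ω _ hω
        rw [huω, if_neg hω, inner_zero_right]
    have hnorm : ‖u‖ ^ 2 = S / σ ^ 2 := by
      rw [EuclideanSpace.real_norm_sq_eq, hS, sum_div, ← sum_subset (subset_univ (W' \ W))]
      · refine sum_congr rfl fun ω hω => ?_
        rw [huω, if_pos hω, neg_sq, div_pow]
      · intro ω _ hω
        rw [huω, if_neg hω, zero_pow two_ne_zero]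
    rw [hinner, hnorm] at hs
    have : -(S / σ) + σ / 2 * (S / σ ^ 2) = -(S / (2 * σ)) := by
      field_simp
      ring
    linarith
  have hS' : μ / (α * σ) * (L lam - Lstar) ≤ S / (2 * σ) := by
    calc μ / (α * σ) * (L lam - Lstar) ≤ μ / (α * σ) * (1 / (2 * μ) * (α * S)) :=
          mul_le_mul_of_nonneg_left hgap (by positivity)
      _ = S / (2 * σ) := by
          have : α ≠ 0 := by positivity
          field_simp
  linarith
end

section
/- (Inexact active-set step: per-iteration linear progress.) Let L : ℝ^N → ℝ be convex, differentiable, and σ-smooth, attaining its minimum value L* over { λ ∈ ℝ^N : λ ≤ 0 }. Suppose there is μ with 0 < μ ≤ σ such that for all λ ≤ 0: L(λ) − L* ≤ (1/(2μ)) · Σ_{ω=1}^N d(λ_ω, ∂L/∂λ_ω(λ), μ). Let W ⊆ W' ⊆ {1,…,N} and λ ∈ Λ_W. Define λ^{1/2} by λ^{1/2}_ω = min{0, λ_ω − (1/σ)·∂L/∂λ_ω(λ)} for ω ∈ W' and λ^{1/2}_ω = λ_ω otherwise, and let λ' ∈ Λ_{W'} be any point with L(λ') ≤ L(λ^{1/2}).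 If α ≥ 1 satisfies α · Σ_{ω ∈ W'\W} (max{∂L/∂λ_ω(λ), 0})² ≥ Σ_{ω ∉ W} (max{∂L/∂λ_ω(λ), 0})², then L(λ') − L* ≤ (1 − μ/(α·σ)) · (L(λ) − L*). -/
open Finset
open scoped RealInnerProductSpace

/-- Decrease of the scaled model at the projected gradient step, compared with any feasible
displacement for a smaller curvature constant. -/
theorem projected_step_model_le {lam θ μ σ t u : ℝ} (hlam : lam ≤ 0) (hμ : 0 ≤ μ) (hσ : 0 < σ)
    (hμσ : μ ≤ σ) (ht : t = min 0 (lam - 1 / σ * θ)) (hu : u ≤ 0) :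
    σ * (θ * (t - lam) + σ / 2 * (t - lam) ^ 2) ≤
      μ * (θ * (u - lam) + μ / 2 * (u - lam) ^ 2) := by
  rcases le_total 0 (lam - 1 / σ * θ) with h | h
  · rw [min_eq_left h] at ht
    subst ht
    have h1 : θ ≤ σ * lam := by
      have h2 : 0 ≤ σ * (lam - 1 / σ * θ) := mul_nonneg hσ.le h
      have h3 : σ * (lam - 1 / σ * θ) = σ * lam - θ := by field_simp
      linarith
    have h2 : μ * (u - lam) ≤ -(σ * lam) := by nlinarith
    nlinarith [mul_nonneg (sub_nonneg.2 h2)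
      (show 0 ≤ -2 * θ + σ * lam - μ * (u - lam) by linarith)]
  · rw [min_eq_right h] at ht
    have h1 : σ * (t - lam) = -θ := by
      rw [ht]
      field_simp
      ring
    have h2 : σ * (θ * (t - lam) + σ / 2 * (t - lam) ^ 2) =
        θ * (σ * (t - lam)) + (σ * (t - lam)) ^ 2 / 2 := by ring
    rw [h2, h1]
    nlinarith [sq_nonneg (μ * (u - lam) + θ)]

theorem dfun_le_projected_step {lam θ μ σ t : ℝ} (hlam : lam ≤ 0) (hμ : 0 < μ) (hμσ : μ ≤ σ)
    (ht : t = min 0 (lam - 1 / σ * θ)) :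
    dfun lam θ μ ≤ -(2 * σ) * (θ * (t - lam) + σ / 2 * (t - lam) ^ 2) := by
  have hσ : 0 < σ := hμ.trans_le hμσ
  have h : σ * (θ * (t - lam) + σ / 2 * (t - lam) ^ 2) / μ ≤
      sInf {v : ℝ | ∃ t : ℝ, t ≤ 0 ∧ v = θ * (t - lam) + μ / 2 * (t - lam) ^ 2} := by
    refine le_csInf ⟨_, 0, le_rfl, rfl⟩ ?_
    rintro v ⟨u, hu, rfl⟩
    rw [div_le_iff₀' hμ]
    exact projected_step_model_le hlam hμ.le hσ hμσ ht hu
  rw [div_le_iff₀' hμ] at h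
  unfold dfun
  linarith

theorem projected_step_from_zero {θ σ t : ℝ} (hσ : 0 < σ) (ht : t = min 0 (0 - 1 / σ * θ)) :
    -(2 * σ) * (θ * (t - 0) + σ / 2 * (t - 0) ^ 2) = (max θ 0) ^ 2 := by
  have h1 : σ * t = -max θ 0 := by
    rw [ht, mul_min_of_nonneg _ _ hσ.le, ← min_neg_neg, min_comm]
    congr 1
    · field_simp
      ring
    · simp
  have h2 : -(2 * σ) * (θ * (t - 0) + σ / 2 * (t - 0) ^ 2) =
      -2 * θ * (σ * t) - (σ * t) ^ 2 := by ring
  rw [h2, h1]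
  rcases le_total θ 0 with h | h
  · simp [max_eq_right h]
  · rw [max_eq_left h]
    ring

/-- Inexact active-set step, per-iteration linear progress: under convexity, `σ`-smoothness,
attainment of the minimum `L*` over the nonpositive orthant, the proximal-PL inequality with
constant `0 < μ ≤ σ`, `λ ∈ Λ_W` with `W ⊆ W'`, `λ^{1/2}` one projected gradient step from `λ`
over the coordinates in `W'`, any `λ' ∈ Λ_{W'}` with `L(λ') ≤ L(λ^{1/2})`, and the
augmentation condition with constant `α ≥ 1`, one has
`L(λ') − L* ≤ (1 − μ/(α·σ))·(L(λ) − L*)`. -/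
theorem stmt16 (N : ℕ) (σ : ℝ) (hσ : 0 < σ)
    (L : EuclideanSpace ℝ (Fin N) → ℝ)
    (g : EuclideanSpace ℝ (Fin N) → EuclideanSpace ℝ (Fin N))
    (hconv : ConvexOn ℝ Set.univ L)
    (hgrad : ∀ x, HasGradientAt L (g x) x)
    (hsmooth : ∀ a b : EuclideanSpace ℝ (Fin N),
      L b ≤ L a + ⟪g a, b - a⟫ + σ / 2 * ‖b - a‖ ^ 2)
    (Lstar : ℝ)
    (hattain : ∃ z : EuclideanSpace ℝ (Fin N), (∀ ω, z ω ≤ 0) ∧ L z = Lstar)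
    (hlb : ∀ z : EuclideanSpace ℝ (Fin N), (∀ ω, z ω ≤ 0) → Lstar ≤ L z)
    (μ : ℝ) (hμ : 0 < μ) (hμσ : μ ≤ σ)
    (hPL : ∀ z : EuclideanSpace ℝ (Fin N), (∀ ω, z ω ≤ 0) →
      L z - Lstar ≤ (1 / (2 * μ)) * ∑ ω, dfun (z ω) (g z ω) μ)
    (W W' : Finset (Fin N)) (hWW' : W ⊆ W')
    (lam lamHalf lam' : EuclideanSpace ℝ (Fin N))
    (hlamMem : (∀ ω, lam ω ≤ 0) ∧ ∀ ω ∉ W, lam ω = 0)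
    (hHalfW' : ∀ ω ∈ W', lamHalf ω = min 0 (lam ω - (1 / σ) * g lam ω))
    (hHalfNotW' : ∀ ω ∉ W', lamHalf ω = lam ω)
    (hlam'Mem : (∀ ω, lam' ω ≤ 0) ∧ ∀ ω ∉ W', lam' ω = 0)
    (hlam'Desc : L lam' ≤ L lamHalf)
    (α : ℝ) (hα : 1 ≤ α)
    (haug : α * ∑ ω ∈ W' \ W, (max (g lam ω) 0) ^ 2 ≥
      ∑ ω ∈ Wᶜ, (max (g lam ω) 0) ^ 2) :
    L lam' - Lstar ≤ (1 - μ / (α * σ)) * (L lam - Lstar) := by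
  classical
  obtain ⟨hlam0, hlamW⟩ := hlamMem
  set E : Fin N → ℝ := fun ω ↦ -(2 * σ) *
    (g lam ω * (min 0 (lam ω - 1 / σ * g lam ω) - lam ω) +
      σ / 2 * (min 0 (lam ω - 1 / σ * g lam ω) - lam ω) ^ 2) with hE
  have hEd : ∀ ω, dfun (lam ω) (g lam ω) μ ≤ E ω := fun ω ↦
    dfun_le_projected_step (hlam0 ω) hμ hμσ rfl
  have hE0 : ∀ ω, 0 ≤ E ω := fun ω ↦ by
    have h := projected_step_model_le (θ := g lam ω) (hlam0 ω) hσ.le hσ le_rfl rfl (hlam0 ω)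
    simp only [hE]
    simp only [sub_self] at h
    linarith
  have hEz : ∀ ω, ω ∉ W → E ω = (max (g lam ω) 0) ^ 2 := fun ω hω ↦ by
    simp only [hE, hlamW ω hω]
    exact projected_step_from_zero hσ rfl
  have hsplit : ∑ ω, E ω = ∑ ω ∈ W, E ω + ∑ ω ∈ Wᶜ, E ω := (sum_add_sum_compl W E).symm
  have hsplit' : ∑ ω ∈ W', E ω = ∑ ω ∈ W' \ W, E ω + ∑ ω ∈ W, E ω :=
    (sum_sdiff hWW').symm
  have hc : ∑ ω ∈ Wᶜ, E ω = ∑ ω ∈ Wᶜ, (max (g lam ω) 0) ^ 2 :=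
    sum_congr rfl fun ω hω ↦ hEz ω (mem_compl.1 hω)
  have hd : ∑ ω ∈ W' \ W, E ω = ∑ ω ∈ W' \ W, (max (g lam ω) 0) ^ 2 :=
    sum_congr rfl fun ω hω ↦ hEz ω (mem_sdiff.1 hω).2
  have hW : 0 ≤ ∑ ω ∈ W, E ω := sum_nonneg fun ω _ ↦ hE0 ω
  have hsum : ∑ ω, dfun (lam ω) (g lam ω) μ ≤ α * ∑ ω ∈ W', E ω := by
    have h1 : ∑ ω, dfun (lam ω) (g lam ω) μ ≤ ∑ ω, E ω := sum_le_sum fun ω _ ↦ hEd ω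
    rw [hsplit, hc] at h1
    rw [hsplit', hd]
    nlinarith
  have hdesc : 2 * σ * (L lamHalf - L lam) ≤ -∑ ω ∈ W', E ω := by
    have h1 : ⟪g lam, lamHalf - lam⟫ + σ / 2 * ‖lamHalf - lam‖ ^ 2 =
        ∑ ω, (g lam ω * (lamHalf ω - lam ω) + σ / 2 * (lamHalf ω - lam ω) ^ 2) := by
      rw [EuclideanSpace.real_norm_sq_eq, PiLp.inner_apply, mul_sum, ← sum_add_distrib]
      refine sum_congr rfl fun ω _ ↦ ?_
      simp [mul_comm]
    have h2 : ∑ ω, (g lam ω * (lamHalf ω - lam ω) + σ / 2 * (lamHalf ω - lam ω) ^ 2) =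
        ∑ ω ∈ W', (g lam ω * (lamHalf ω - lam ω) + σ / 2 * (lamHalf ω - lam ω) ^ 2) := by
      refine (sum_subset (subset_univ _) fun ω _ hω ↦ ?_).symm
      simp [hHalfNotW' ω hω]
    have h3 : ∑ ω ∈ W', E ω = -(2 * σ) *
        ∑ ω ∈ W', (g lam ω * (lamHalf ω - lam ω) + σ / 2 * (lamHalf ω - lam ω) ^ 2) := by
      rw [mul_sum]
      refine sum_congr rfl fun ω hω ↦ ?_
      rw [hHalfW' ω hω]
    have h4 := hsmooth lam lamHalf
    rw [h3, ← h2, ← h1]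
    nlinarith
  have hα0 : 0 < α := one_pos.trans_le hα
  have hPLlam : 2 * μ * (L lam - Lstar) ≤ α * ∑ ω ∈ W', E ω := by
    have h1 := hPL lam hlam0
    rw [one_div, ← div_eq_inv_mul, le_div_iff₀' (by positivity)] at h1
    exact h1.trans hsum
  have hprog : μ * (L lam - Lstar) ≤ α * σ * (L lam - L lamHalf) := by
    nlinarith
  have hquot : μ / (α * σ) * (L lam - Lstar) ≤ L lam - L lamHalf := by
    rw [div_mul_eq_mul_div, div_le_iff₀' (by positivity)]
    exact hprog
  linarith
end

section
/- Let x_1,…,x_n ∈ ℝ^d, φ ∈ ℝ^n, and ξ_1,…,ξ_n ∈ ℝ^d. Define v_{(i,j)} = φ_j − φ_i − ⟨x_j − x_i, ξ_i⟩ for i ≠ j and v_{(j,j)} = 0, let ν_j = min_{1≤i≤n} v_{(i,j)}, for each j pick any κ_j ∈ argmin_{1≤i≤n} v_{(i,j)}, and for any constant c ∈ ℝ set ξ̃_j = ξ_{κ_j} and φ̃_j = φ_j − ν_j + c. Then (φ̃, ξ̃) is feasible for the convex regression constraints: φ̃_j − φ̃_i ≥ ⟨x_j − x_i, ξ̃_i⟩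 for all i ≠ j. -/
open Finset

/-- Constraint slack `v_{(i,j)} = φ_j − φ_i − ⟨x_j − x_i, ξ_i⟩` (note `v_{(j,j)} = 0`). -/
def slack {n d : ℕ} (x : Fin n → Fin d → ℝ) (φ : Fin n → ℝ) (ξ : Fin n → Fin d → ℝ)
    (i j : Fin n) : ℝ :=
  φ j - φ i - ∑ t, (x j t - x i t) * ξ i t

/-- Feasibility of the piecewise-maximum construction: if for each `j`, `κ j` is a minimizer
of `i ↦ v_{(i,j)}` (so `ν_j = v_{(κ_j, j)} = min_i v_{(i,j)}`), and we set
`ξ̃_j = ξ_{κ_j}` and `φ̃_j = φ_j − ν_j + c`, then `(φ̃, ξ̃)` satisfies the convex regression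
constraints `φ̃_j − φ̃_i ≥ ⟨x_j − x_i, ξ̃_i⟩` for all `i ≠ j`. -/
theorem stmt17 (n d : ℕ) (x : Fin n → Fin d → ℝ) (φ : Fin n → ℝ) (ξ : Fin n → Fin d → ℝ)
    (κ : Fin n → Fin n) (hκ : ∀ j i, slack x φ ξ (κ j) j ≤ slack x φ ξ i j) (c : ℝ) :
    ∀ i j : Fin n, i ≠ j →
      (φ j - slack x φ ξ (κ j) j + c) - (φ i - slack x φ ξ (κ i) i + c) ≥
        ∑ t, (x j t - x i t) * ξ (κ i) t := by
  intro i j _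
  have h_min := hκ j (κ i)
  have h_split : ∑ t, (x j t - x (κ i) t) * ξ (κ i) t - ∑ t, (x i t - x (κ i) t) * ξ (κ i) t =
      ∑ t, (x j t - x i t) * ξ (κ i) t := by
    rw [← Finset.sum_sub_distrib]
    exact Finset.sum_congr rfl fun t _ => by ring
  have h_i : slack x φ ξ (κ i) i =
      φ i - φ (κ i) - ∑ t, (x i t - x (κ i) t) * ξ (κ i) t := rfl
  have h_j : slack x φ ξ (κ i) j =
      φ j - φ (κ i) - ∑ t, (x j t - x (κ i) t) * ξ (κ i) t := rfl
  linarith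
end

section
/- Let (φ*, ξ*) be the unique minimizer of the convex regression primal problem (P). Define v*_{(i,j)} = φ*_j − φ*_i − ⟨x_j − x_i, ξ*_i⟩ for i ≠ j and v*_{(j,j)} = 0. Then: (i) min_{1≤i≤n} v*_{(i,j)} = 0 for every j; (ii) Σ_{i=1}^n φ*_i = Σ_{i=1}^n y_i; and (iii) for every j and every index k ∈ argmin_{1≤i≤n} v*_{(i,j)} with ‖ξ*_k‖ ≤ ‖ξ*_j‖, one has ξ*_k = ξ*_j. Consequently, (φ*, ξ*) is a fixed point of the feasibility map ψ that sends (φ, ξ) to (φ − ν + c·1, (ξ_{κ_j})_j) with κ_j a minimal-norm minimizer of v_{(·,j)} and c chosen so that the mean of the output φ-vector equals the mean of y. -/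
open Finset

/-- Convex regression objective `f(φ,ξ) = (1/2)Σ(yᵢ−φᵢ)² + (ρ/2)Σ‖ξᵢ‖²`. -/
noncomputable def crObj {n d : ℕ} (y : Fin n → ℝ) (ρ : ℝ)
    (φ : Fin n → ℝ) (ξ : Fin n → Fin d → ℝ) : ℝ :=
  (1 / 2) * ∑ i, (y i - φ i) ^ 2 + ρ / 2 * ∑ i, ∑ t, ξ i t ^ 2

theorem slack_self {n d : ℕ} (x : Fin n → Fin d → ℝ) (φ : Fin n → ℝ) (ξ : Fin n → Fin d → ℝ)
    (j : Fin n) : slack x φ ξ j j = 0 := by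
  simp [slack]

theorem slack_add_const {n d : ℕ} (x : Fin n → Fin d → ℝ) (φ : Fin n → ℝ)
    (ξ : Fin n → Fin d → ℝ) (c : ℝ) (i j : Fin n) :
    slack x (fun l => φ l + c) ξ i j = slack x φ ξ i j := by
  simp [slack]

theorem slack_update_of_ne {n d : ℕ} (x : Fin n → Fin d → ℝ) (φ : Fin n → ℝ)
    (ξ : Fin n → Fin d → ℝ) (v : Fin d → ℝ) {i j : Fin n} (hij : i ≠ j) (l : Fin n) :
    slack x φ (Function.update ξ j v) i l = slack x φ ξ i l := by
  simp [slack, Function.update_of_ne hij]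

theorem slack_update_self {n d : ℕ} (x : Fin n → Fin d → ℝ) (φ : Fin n → ℝ)
    (ξ : Fin n → Fin d → ℝ) (j k l : Fin n) :
    slack x φ (Function.update ξ j (ξ k)) j l = slack x φ ξ k l - slack x φ ξ k j := by
  have h : ∑ t, (x l t - x j t) * ξ k t
      = ∑ t, (x l t - x k t) * ξ k t - ∑ t, (x j t - x k t) * ξ k t := by
    rw [← Finset.sum_sub_distrib]
    exact Finset.sum_congr rfl fun t _ => by ring
  simp only [slack, Function.update_self, h]
  ring

theorem crObj_add_const {n d : ℕ} (y : Fin n → ℝ) (ρ : ℝ) (φ : Fin n → ℝ)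
    (ξ : Fin n → Fin d → ℝ) (c : ℝ) :
    crObj y ρ (fun i => φ i + c) ξ
      = crObj y ρ φ ξ - c * (∑ i, y i - ∑ i, φ i) + n * c ^ 2 / 2 := by
  have h : ∑ i, (y i - (φ i + c)) ^ 2
      = ∑ i, (y i - φ i) ^ 2 - 2 * c * (∑ i, y i - ∑ i, φ i) + n * c ^ 2 := by
    have hc : (n : ℝ) * c ^ 2 = ∑ _i : Fin n, c ^ 2 := by simp
    rw [hc, ← Finset.sum_sub_distrib, Finset.mul_sum, ← Finset.sum_sub_distrib,
      ← Finset.sum_add_distrib]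
    exact Finset.sum_congr rfl fun i _ => by ring
  simp only [crObj, h]
  ring

theorem crObj_update_le {n d : ℕ} (y : Fin n → ℝ) {ρ : ℝ} (hρ : 0 ≤ ρ) (φ : Fin n → ℝ)
    (ξ : Fin n → Fin d → ℝ) {j : Fin n} {v : Fin d → ℝ}
    (hv : ∑ t, v t ^ 2 ≤ ∑ t, ξ j t ^ 2) :
    crObj y ρ φ (Function.update ξ j v) ≤ crObj y ρ φ ξ := by
  unfold crObj
  gcongr _ + ρ / 2 * ?_
  refine Finset.sum_le_sum fun i _ => ?_
  rcases eq_or_ne i j with rfl | hij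
  · simpa using hv
  · simp [Function.update_of_ne hij]

/-- Properties of the unique minimizer `(φ*, ξ*)` of the convex regression problem:
(i) `min_i v*_{(i,j)} = 0` for every `j`; (ii) `Σ φ*_i = Σ y_i`; (iii) every minimal-slack
index `k` for column `j` with `‖ξ*_k‖ ≤ ‖ξ*_j‖` satisfies `ξ*_k = ξ*_j`; consequently
`(φ*, ξ*)` is a fixed point of the feasibility map `ψ`. -/
theorem stmt18 (n d : ℕ) (hn : 0 < n)
    (x : Fin n → Fin d → ℝ) (y : Fin n → ℝ) (ρ : ℝ) (hρ : 0 < ρ)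
    (φs : Fin n → ℝ) (ξs : Fin n → Fin d → ℝ)
    (hfeas : ∀ i j : Fin n, i ≠ j → 0 ≤ slack x φs ξs i j)
    (hmin : ∀ (φ : Fin n → ℝ) (ξ : Fin n → Fin d → ℝ),
      (∀ i j : Fin n, i ≠ j → 0 ≤ slack x φ ξ i j) →
      crObj y ρ φs ξs ≤ crObj y ρ φ ξ)
    (huniq : ∀ (φ : Fin n → ℝ) (ξ : Fin n → Fin d → ℝ),
      (∀ i j : Fin n, i ≠ j → 0 ≤ slack x φ ξ i j) →
      (∀ (φ' : Fin n → ℝ) (ξ' : Fin n → Fin d → ℝ),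
        (∀ i j : Fin n, i ≠ j → 0 ≤ slack x φ' ξ' i j) →
        crObj y ρ φ ξ ≤ crObj y ρ φ' ξ') → φ = φs ∧ ξ = ξs) :
    -- (i) the minimum slack in every column is zero
    (∀ j : Fin n,
      Finset.univ.inf' ⟨⟨0, hn⟩, Finset.mem_univ _⟩ (fun i => slack x φs ξs i j) = 0) ∧
    -- (ii) the fitted values and the responses have the same sum (hence the same mean)
    (∑ i, φs i = ∑ i, y i) ∧
    -- (iii) minimal-slack indices of no larger subgradient norm carry the same subgradient
    (∀ j k : Fin n, (∀ i, slack x φs ξs k j ≤ slack x φs ξs i j) →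
      (∑ t, ξs k t ^ 2 ≤ ∑ t, ξs j t ^ 2) → ξs k = ξs j) ∧
    -- consequently, (φ*, ξ*) is a fixed point of the feasibility map ψ
    (∀ (κ : Fin n → Fin n) (c : ℝ),
      (∀ j i, slack x φs ξs (κ j) j ≤ slack x φs ξs i j) →
      (∀ j k : Fin n, (∀ i, slack x φs ξs k j ≤ slack x φs ξs i j) →
        ∑ t, ξs (κ j) t ^ 2 ≤ ∑ t, ξs k t ^ 2) →
      (∑ j, (φs j - slack x φs ξs (κ j) j + c) = ∑ j, y j) →
      (∀ j, φs j - slack x φs ξs (κ j) j + c = φs j) ∧ (∀ j, ξs (κ j) = ξs j)) := by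
  have hnn : ∀ i j, 0 ≤ slack x φs ξs i j := fun i j => by
    rcases eq_or_ne i j with rfl | hij
    · exact (slack_self x φs ξs i).ge
    · exact hfeas i j hij
  have hzero : ∀ j k, (∀ i, slack x φs ξs k j ≤ slack x φs ξs i j) → slack x φs ξs k j = 0 :=
    fun j k hk => le_antisymm ((hk j).trans_eq (slack_self x φs ξs j)) (hnn k j)
  have hn' : (0 : ℝ) < n := Nat.cast_pos.2 hn
  have hsum : ∑ i, φs i = ∑ i, y i := by
    set S := ∑ i, y i - ∑ i, φs i with hS
    have h := hmin (fun i => φs i + S / n) ξs fun i j hij => by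
      rw [slack_add_const]
      exact hfeas i j hij
    rw [crObj_add_const, ← hS] at h
    have he : (n : ℝ) * (S / n) ^ 2 / 2 = S / n * S / 2 := by field_simp
    have hle : S * S / n ≤ 0 := by
      rw [mul_div_right_comm]
      linarith
    have hS0 : S * S ≤ 0 := by simpa using (div_le_iff₀ hn').1 hle
    have : S = 0 := mul_self_eq_zero.1 (le_antisymm hS0 (mul_self_nonneg S))
    linarith
  have hsub : ∀ j k : Fin n, (∀ i, slack x φs ξs k j ≤ slack x φs ξs i j) →
      (∑ t, ξs k t ^ 2 ≤ ∑ t, ξs j t ^ 2) → ξs k = ξs j := fun j k hk hnorm => by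
    have hup := (huniq φs (Function.update ξs j (ξs k)) (fun i l _ => by
      rcases eq_or_ne i j with rfl | hij
      · rw [slack_update_self, hzero i k hk, sub_zero]
        exact hnn k l
      · rw [slack_update_of_ne x φs ξs _ hij]
        exact hnn i l) fun φ' ξ' h' =>
        (crObj_update_le y hρ.le φs ξs hnorm).trans (hmin φ' ξ' h')).2
    simpa using congrFun hup j
  refine ⟨fun j => le_antisymm ?_ (Finset.le_inf' _ _ fun i _ => hnn i j), hsum, hsub, ?_⟩
  · exact (Finset.inf'_le _ (Finset.mem_univ j)).trans_eq (slack_self x φs ξs j)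
  · intro κ c hκ hκn hc
    have hκ0 : ∀ j, slack x φs ξs (κ j) j = 0 := fun j => hzero j (κ j) (hκ j)
    have hc0 : c = 0 := by
      simpa [hκ0, Finset.sum_add_distrib, hsum, hn.ne'] using hc
    refine ⟨fun j => by rw [hκ0, hc0, sub_zero, add_zero], fun j => hsub j (κ j) (hκ j) ?_⟩
    exact hκn j j fun i => (slack_self x φs ξs j).trans_le (hnn i j)
end
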